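/- For every positive integer n, the circulant graph C_{16n+12}({1, 4n+2, 8n+5}) is edge-transitive. -/

import Mathlib

/-- A graph is edge-transitive if its automorphism group acts transitively on its edge set. -/
def EdgeTransitive {V : Type*} (G : SimpleGraph V) : Prop :=
  ∀ e₁ ∈ G.edgeSet, ∀ e₂ ∈ G.edgeSet, ∃ φ : G ≃g G, Sym2.map φ e₁ = e₂

/-- The circulant graph `C_n(L)` on vertex set `ZMod n`: distinct vertices `x`, `y` are
adjacent iff `x - y ≡ ±l (mod n)` for some `l ∈ L`. -/
def circulant (n : ℕ) (L : Finset ℤ) : SimpleGraph (ZMod n) :=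
  SimpleGraph.circulantGraph {x : ZMod n | ∃ l ∈ L, x = (l : ZMod n)}

/-- The symmetric group on `α` acts transitively on ordered pairs of distinct points. -/
theorem exists_perm_map_pair {α : Type*} {a b a' b' : α} (h : a ≠ b) (h' : a' ≠ b') :
    ∃ σ : Equiv.Perm α, σ a = a' ∧ σ b = b' := by
  classical
  refine ⟨(Equiv.swap a a').trans (Equiv.swap (Equiv.swap a a' b) b'), ?_, by simp⟩
  have hne : a' ≠ Equiv.swap a a' b := fun hc =>
    h ((Equiv.swap a a').injective (by rw [Equiv.swap_apply_left]; exact hc))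
  simp [Equiv.swap_apply_of_ne_of_ne hne h']

/-- The direct product of a complete graph on `α` with the Cayley graph of a ring `R` with
connection set `{1, -1}` is edge-transitive. -/
theorem edgeTransitive_of_equiv_prod {V α R : Type*} [CommRing R] (G : SimpleGraph V)
    (e : V ≃ α × R)
    (hG : ∀ x y, G.Adj x y ↔
      (e x).1 ≠ (e y).1 ∧ ((e x).2 - (e y).2 = 1 ∨ (e x).2 - (e y).2 = -1)) :
    EdgeTransitive G := by
  intro e₁ h₁ e₂ h₂
  induction e₁ with | _ x y
  induction e₂ with | _ x' y'
  rw [SimpleGraph.mem_edgeSet] at h₁ h₂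
  obtain ⟨hne, hd⟩ := (hG x y).1 h₁
  obtain ⟨hne', hd'⟩ := (hG x' y').1 h₂
  obtain ⟨σ, hσx, hσy⟩ := exists_perm_map_pair hne hne'
  obtain ⟨ε, hε, hεd⟩ : ∃ ε : ℤˣ, (ε = 1 ∨ ε = -1) ∧
      ε • ((e x).2 - (e y).2) = (e x').2 - (e y').2 := by
    rcases hd with hd | hd <;> rcases hd' with hd' | hd' <;> rw [hd, hd']
    · exact ⟨1, by simp⟩
    · exact ⟨-1, by simp⟩
    · exact ⟨-1, by simp⟩
    · exact ⟨1, by simp⟩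
  let τ : Equiv.Perm R :=
    ((Equiv.subRight (e x).2).trans (MulAction.toPerm ε)).trans (Equiv.addRight (e x').2)
  have hτ : ∀ t, τ t = ε • (t - (e x).2) + (e x').2 := fun _ => rfl
  have hτsub : ∀ s t, τ s - τ t = ε • (s - t) := fun s t => by
    rw [hτ, hτ, add_sub_add_right_eq_sub, ← smul_sub, sub_sub_sub_cancel_right]
  have hτx : τ (e x).2 = (e x').2 := by simp [hτ]
  have hτy : τ (e y).2 = (e y').2 := by
    have := hτsub (e x).2 (e y).2
    rw [hεd, hτx] at this
    exact sub_right_injective this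
  let φ : V ≃ V := (e.trans (σ.prodCongr τ)).trans e.symm
  have hφ : ∀ v, e (φ v) = (σ (e v).1, τ (e v).2) := fun v =>
    e.apply_symm_apply _
  refine ⟨⟨φ, fun {v w} => ?_⟩, ?_⟩
  · rw [hG, hG, hφ, hφ]
    simp only [hτsub, ne_eq, σ.injective.eq_iff]
    rcases hε with rfl | rfl
    · simp
    · simp only [Units.neg_smul, one_smul, neg_eq_iff_eq_neg, neg_neg]
      rw [or_comm]
  · have hx : φ x = x' := e.injective (by rw [hφ, hσx, hτx])
    have hy : φ y = y' := e.injective (by rw [hφ, hσy, hτy])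
    simp [hx, hy]

/-- The Chinese remainder isomorphism turns the circulant graph
`C_{16n+12}({1, 4n+2, 8n+5})` into a direct product of `K₄` and a cycle. -/
theorem circulant_adj_iff (n : ℕ) (e : ZMod (16 * n + 12) ≃+* ZMod 4 × ZMod (4 * n + 3))
    (x y : ZMod (16 * n + 12)) :
    (circulant (16*n+12) ({1, 4*(n:ℤ)+2, 8*(n:ℤ)+5} : Finset ℤ)).Adj x y ↔
      (e x).1 ≠ (e y).1 ∧ ((e x).2 - (e y).2 = 1 ∨ (e x).2 - (e y).2 = -1) := by
  have h4 : (4 : ZMod 4) = 0 := rfl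
  have hm : 4 * (n : ZMod (4 * n + 3)) + 3 = 0 := by
    exact_mod_cast ZMod.natCast_self (4 * n + 3)
  have e1 : e ((1 : ℤ) : ZMod (16 * n + 12)) = (1, 1) := by simp [Prod.ext_iff]
  have e2 : e ((4 * (n : ℤ) + 2 : ℤ) : ZMod (16 * n + 12)) = (2, -1) := by
    rw [map_intCast]
    ext
    · simp [h4]
    · simp only [Prod.snd_intCast]; push_cast; linear_combination hm
  have e3 : e ((8 * (n : ℤ) + 5 : ℤ) : ZMod (16 * n + 12)) = (1, -1) := by
    rw [map_intCast]
    ext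
    · simp only [Prod.fst_intCast]; push_cast; linear_combination (2 * (n : ZMod 4) + 1) * h4
    · simp only [Prod.snd_intCast]; push_cast; linear_combination 2 * hm
  have hmem : ∀ d : ZMod (16 * n + 12),
      (∃ l ∈ ({1, 4*(n:ℤ)+2, 8*(n:ℤ)+5} : Finset ℤ), d = (l : ZMod (16 * n + 12))) ↔
        e d = (1, 1) ∨ e d = (2, -1) ∨ e d = (1, -1) := fun d => by
    rw [← e1, ← e2, ← e3]
    simp only [e.injective.eq_iff, Finset.mem_insert, Finset.mem_singleton, exists_eq_or_imp,
      exists_eq_left]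
  have hcases : ∀ a : ZMod 4, a = 0 ∨ a = 1 ∨ a = 2 ∨ a = 3 := by decide
  have hneg : -(1 : ZMod 4) = 3 ∧ -(2 : ZMod 4) = 2 := by decide
  have hdist : (1 : ZMod 4) ≠ 0 ∧ (2 : ZMod 4) ≠ 0 ∧ (3 : ZMod 4) ≠ 0 ∧ (1 : ZMod 4) ≠ 2 ∧
    (1 : ZMod 4) ≠ 3 ∧ (2 : ZMod 4) ≠ 3 := by decide
  have hxy : ¬x = y ↔ e (x - y) ≠ 0 := by simp [sub_eq_zero]
  have hyx : e (y - x) = -e (x - y) := by simp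
  rw [circulant, SimpleGraph.circulantGraph_adj, Set.mem_ofPred_eq, Set.mem_ofPred_eq, hmem, hmem,
    hyx, hxy, ← sub_ne_zero (a := (e x).1), ← Prod.fst_sub, ← Prod.snd_sub, ← map_sub]
  obtain ⟨a, b⟩ := e (x - y)
  simp only [Prod.neg_mk, Prod.mk.injEq, ne_eq, Prod.mk_eq_zero, neg_eq_iff_eq_neg, neg_neg, hneg]
  rcases hcases a with rfl | rfl | rfl | rfl <;>
    simp [hdist, hdist.1.symm, hdist.2.2.2.1.symm, hdist.2.2.2.2.1.symm,
      hdist.2.2.2.2.2.symm] <;> tauto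

/-- This circulant graph is edge-transitive for every positive integer `n`. -/
theorem circulant_class_edgeTransitive (n : ℕ) (hn : 0 < n) :
    EdgeTransitive (circulant (16*n+12) ({1, 4*(n:ℤ)+2, 8*(n:ℤ)+5} : Finset ℤ)) := by
  have hcop : Nat.Coprime 4 (4 * n + 3) := by simp; decide
  let e := (ZMod.ringEquivCongr (by ring : 16 * n + 12 = 4 * (4 * n + 3))).trans
    (ZMod.chineseRemainder hcop)
  exact edgeTransitive_of_equiv_prod _ e.toEquiv (circulant_adj_iff n e)
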